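/- arXiv:2212.12267 — 6 statements merged into one kernel-verified Lean document; each statement's English description precedes it below -/
import Mathlib

section
/- For all natural numbers k and all smooth compactly supported functions f, g, h on phase space ℝ^N × ℝ^N, the integral over ℝ^{2N} of f·(g D_ω^k h) equals the integral over ℝ^{2N} of (f D_ω^k g)·h. -/
/-- Partial derivative in the position variable `q i` on phase space `ℝ^N × ℝ^N`. -/
noncomputable def dq (N : ℕ) (i : Fin N) (f : (Fin N → ℝ) × (Fin N → ℝ) → ℝ) :
    (Fin N → ℝ) × (Fin N → ℝ) → ℝ :=
  fun x => fderiv ℝ f x (Pi.single i 1, 0)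

/-- Partial derivative in the momentum variable `p i` on phase space `ℝ^N × ℝ^N`. -/
noncomputable def dp (N : ℕ) (i : Fin N) (f : (Fin N → ℝ) × (Fin N → ℝ) → ℝ) :
    (Fin N → ℝ) × (Fin N → ℝ) → ℝ :=
  fun x => fderiv ℝ f x (0, Pi.single i 1)

/-- Iterated bidifferential operator: `Dpow N k f g = f D_ω^k g`, with
`f D_ω^0 g = f·g` and
`f D_ω^{k+1} g = ∑ i ((∂f/∂q_i) D_ω^k (∂g/∂p_i) − (∂f/∂p_i) D_ω^k (∂g/∂q_i))`. -/
noncomputable def Dpow (N : ℕ) : ℕ → ((Fin N → ℝ) × (Fin N → ℝ) → ℝ) →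
    ((Fin N → ℝ) × (Fin N → ℝ) → ℝ) → (Fin N → ℝ) × (Fin N → ℝ) → ℝ
  | 0, f, g => fun x => f x * g x
  | k + 1, f, g => fun x =>
      ∑ i : Fin N, (Dpow N k (dq N i f) (dp N i g) x - Dpow N k (dp N i f) (dq N i g) x)

open MeasureTheory

section DirectionalDerivative

variable {E : Type*} [NormedAddCommGroup E] [NormedSpace ℝ E]

/-- The derivative of a smooth function in a fixed direction is smooth. -/
theorem contDiff_fderiv_apply_const {f : E → ℝ} (hf : ContDiff ℝ (⊤ : ℕ∞) f) (v : E) :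
    ContDiff ℝ (⊤ : ℕ∞) (fun x => fderiv ℝ f x v) :=
  (hf.fderiv_right (m := (⊤ : ℕ∞)) (by simp)).clm_apply contDiff_const

/-- Directional derivatives of a smooth function commute. -/
theorem fderiv_fderiv_apply_comm {f : E → ℝ} (hf : ContDiff ℝ (⊤ : ℕ∞) f) (v w : E) :
    (fun x => fderiv ℝ (fun y => fderiv ℝ f y v) x w) =
      fun x => fderiv ℝ (fun y => fderiv ℝ f y w) x v := by
  funext x
  have hd : DifferentiableAt ℝ (fderiv ℝ f) x :=
    ((hf.fderiv_right (m := (⊤ : ℕ∞)) (by simp)).differentiable (by simp)) x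
  have hs : IsSymmSndFDerivAt ℝ f x :=
    hf.contDiffAt.isSymmSndFDerivAt (by simpa using WithTop.coe_le_coe.2 (le_top : (2 : ℕ∞) ≤ ⊤))
  rw [fderiv_clm_apply hd (by fun_prop), fderiv_clm_apply hd (by fun_prop)]
  simpa using hs w v

end DirectionalDerivative

section Dpow

variable {N : ℕ} {f g h : (Fin N → ℝ) × (Fin N → ℝ) → ℝ}

theorem ContDiff.dq (hf : ContDiff ℝ (⊤ : ℕ∞) f) (i : Fin N) :
    ContDiff ℝ (⊤ : ℕ∞) (dq N i f) :=
  contDiff_fderiv_apply_const hf _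

theorem ContDiff.dp (hf : ContDiff ℝ (⊤ : ℕ∞) f) (i : Fin N) :
    ContDiff ℝ (⊤ : ℕ∞) (dp N i f) :=
  contDiff_fderiv_apply_const hf _

theorem HasCompactSupport.dq (hf : HasCompactSupport f) (i : Fin N) :
    HasCompactSupport (dq N i f) :=
  hf.fderiv_apply ℝ _

theorem HasCompactSupport.dp (hf : HasCompactSupport f) (i : Fin N) :
    HasCompactSupport (dp N i f) :=
  hf.fderiv_apply ℝ _

theorem dp_dq_comm (hf : ContDiff ℝ (⊤ : ℕ∞) f) (i : Fin N) :
    dp N i (dq N i f) = dq N i (dp N i f) :=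
  fderiv_fderiv_apply_comm hf _ _

theorem contDiff_Dpow (k : ℕ) (hf : ContDiff ℝ (⊤ : ℕ∞) f) (hg : ContDiff ℝ (⊤ : ℕ∞) g) :
    ContDiff ℝ (⊤ : ℕ∞) (Dpow N k f g) := by
  induction k generalizing f g with
  | zero => exact hf.mul hg
  | succ k ih =>
    exact ContDiff.sum fun i _ => (ih (hf.dq i) (hg.dp i)).sub (ih (hf.dp i) (hg.dq i))

/-- Leibniz rule for `Dpow` in a constant direction. -/
theorem fderiv_Dpow_apply (k : ℕ) (hf : ContDiff ℝ (⊤ : ℕ∞) f) (hg : ContDiff ℝ (⊤ : ℕ∞) g)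
    (v x : (Fin N → ℝ) × (Fin N → ℝ)) :
    fderiv ℝ (Dpow N k f g) x v =
      Dpow N k (fun y => fderiv ℝ f y v) g x + Dpow N k f (fun y => fderiv ℝ g y v) x := by
  induction k generalizing f g with
  | zero =>
    have h1 := hf.differentiable (by simp) x
    have h2 := hg.differentiable (by simp) x
    simp only [Dpow]
    rw [fderiv_fun_mul h1 h2]
    simp
    ring
  | succ k ih =>
    have hd {a b : (Fin N → ℝ) × (Fin N → ℝ) → ℝ} (ha : ContDiff ℝ (⊤ : ℕ∞) a)
        (hb : ContDiff ℝ (⊤ : ℕ∞) b) : DifferentiableAt ℝ (Dpow N k a b) x :=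
      (contDiff_Dpow k ha hb).differentiable (by simp) x
    have hq {a : (Fin N → ℝ) × (Fin N → ℝ) → ℝ} (ha : ContDiff ℝ (⊤ : ℕ∞) a) (i : Fin N) :
        dq N i (fun y => fderiv ℝ a y v) = fun y => fderiv ℝ (dq N i a) y v :=
      fderiv_fderiv_apply_comm ha _ _
    have hp {a : (Fin N → ℝ) × (Fin N → ℝ) → ℝ} (ha : ContDiff ℝ (⊤ : ℕ∞) a) (i : Fin N) :
        dp N i (fun y => fderiv ℝ a y v) = fun y => fderiv ℝ (dp N i a) y v :=
      fderiv_fderiv_apply_comm ha _ _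
    simp only [Dpow]
    rw [fderiv_fun_sum fun i _ =>
      (hd (hf.dq i) (hg.dp i)).fun_sub (hd (hf.dp i) (hg.dq i)), sum_apply,
      ← Finset.sum_add_distrib]
    refine Finset.sum_congr rfl fun i _ => ?_
    rw [fderiv_fun_sub (hd (hf.dq i) (hg.dp i)) (hd (hf.dp i) (hg.dq i)),
      sub_apply, ih (hf.dq i) (hg.dp i), ih (hf.dp i) (hg.dq i),
      hq hf, hp hf, hq hg, hp hg]
    ring

theorem integrable_mul_Dpow (k : ℕ) (hf : ContDiff ℝ (⊤ : ℕ∞) f) (hg : ContDiff ℝ (⊤ : ℕ∞) g)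
    (hh : ContDiff ℝ (⊤ : ℕ∞) h) (hfc : HasCompactSupport f) :
    Integrable fun x => f x * Dpow N k g h x :=
  (hf.continuous.mul (contDiff_Dpow k hg hh).continuous).integrable_of_hasCompactSupport
    hfc.mul_right

/-- Integration by parts for `Dpow` in a constant direction. -/
theorem integral_mul_Dpow_fderiv_apply (k : ℕ) (hf : ContDiff ℝ (⊤ : ℕ∞) f)
    (hg : ContDiff ℝ (⊤ : ℕ∞) g) (hh : ContDiff ℝ (⊤ : ℕ∞) h) (hfc : HasCompactSupport f)
    (v : (Fin N → ℝ) × (Fin N → ℝ)) :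
    ∫ x, f x * Dpow N k g (fun y => fderiv ℝ h y v) x =
      -(∫ x, fderiv ℝ f x v * Dpow N k g h x) -
        ∫ x, f x * Dpow N k (fun y => fderiv ℝ g y v) h x := by
  have hg' := contDiff_fderiv_apply_const hg v
  have hh' := contDiff_fderiv_apply_const hh v
  have i1 := integrable_mul_Dpow k hf hg' hh hfc
  have i2 := integrable_mul_Dpow k hf hg hh' hfc
  have hD : (fun x => f x * fderiv ℝ (Dpow N k g h) x v) = fun x =>
      f x * Dpow N k (fun y => fderiv ℝ g y v) h x +
        f x * Dpow N k g (fun y => fderiv ℝ h y v) x := by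
    funext x
    rw [fderiv_Dpow_apply k hg hh, mul_add]
  have : (volume : Measure ((Fin N → ℝ) × (Fin N → ℝ))).IsAddHaarMeasure :=
    Measure.prod.instIsAddHaarMeasure _ _
  have key := integral_mul_fderiv_eq_neg_fderiv_mul_of_integrable (μ := volume) (v := v)
    (integrable_mul_Dpow k (contDiff_fderiv_apply_const hf v) hg hh (hfc.fderiv_apply ℝ v))
    (by rw [hD]; exact i1.add i2) (integrable_mul_Dpow k hf hg hh hfc)
    (fun x _ => hf.differentiable (by simp) x)
    (fun x _ => (contDiff_Dpow k hg hh).differentiable (by simp) x)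
  rw [hD, integral_add i1 i2] at key
  linarith

/-- Under the integral, one factor of the Poisson bidifferential operator moves from the second and
third arguments to the first and second. -/
theorem integral_mul_Dpow_succ (k : ℕ) (hf : ContDiff ℝ (⊤ : ℕ∞) f)
    (hg : ContDiff ℝ (⊤ : ℕ∞) g) (hh : ContDiff ℝ (⊤ : ℕ∞) h) (hfc : HasCompactSupport f) :
    ∫ x, f x * Dpow N (k + 1) g h x =
      ∑ i : Fin N, ((∫ x, dq N i f x * Dpow N k (dp N i g) h x) -
        ∫ x, dp N i f x * Dpow N k (dq N i g) h x) := by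
  have i1 (i : Fin N) := integrable_mul_Dpow k hf (hg.dq i) (hh.dp i) hfc
  have i2 (i : Fin N) := integrable_mul_Dpow k hf (hg.dp i) (hh.dq i) hfc
  simp only [Dpow, Finset.mul_sum, mul_sub]
  rw [integral_finsetSum _ fun i _ => (i1 i).sub' (i2 i)]
  refine Finset.sum_congr rfl fun i _ => ?_
  have e1 : _ = -(∫ x, dp N i f x * Dpow N k (dq N i g) h x) -
      ∫ x, f x * Dpow N k (dp N i (dq N i g)) h x :=
    integral_mul_Dpow_fderiv_apply k hf (hg.dq i) hh hfc (0, Pi.single i 1)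
  have e2 : _ = -(∫ x, dq N i f x * Dpow N k (dp N i g) h x) -
      ∫ x, f x * Dpow N k (dq N i (dp N i g)) h x :=
    integral_mul_Dpow_fderiv_apply k hf (hg.dp i) hh hfc (Pi.single i 1, 0)
  rw [dp_dq_comm hg] at e1
  rw [integral_sub (i1 i) (i2 i)]
  change (∫ x, f x * Dpow N k (dq N i g) (dp N i h) x) = _ at e1
  change (∫ x, f x * Dpow N k (dp N i g) (dq N i h) x) = _ at e2
  rw [e1, e2]
  ring

end Dpow

/-- For all `k` and smooth compactly supported `f, g, h` on phase space,
`∫ f · (g D_ω^k h) = ∫ (f D_ω^k g) · h` with respect to Lebesgue measure on `ℝ^{2N}`. -/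
theorem statement3 (N k : ℕ) (f g h : (Fin N → ℝ) × (Fin N → ℝ) → ℝ)
    (hf : ContDiff ℝ (⊤ : ℕ∞) f) (hg : ContDiff ℝ (⊤ : ℕ∞) g) (hh : ContDiff ℝ (⊤ : ℕ∞) h)
    (hfc : HasCompactSupport f) (hgc : HasCompactSupport g) (hhc : HasCompactSupport h) :
    ∫ x, f x * Dpow N k g h x = ∫ x, Dpow N k f g x * h x := by
  induction k generalizing f g with
  | zero => simp only [Dpow, mul_assoc]
  | succ k ih =>
    have hi {a b : (Fin N → ℝ) × (Fin N → ℝ) → ℝ} (ha : ContDiff ℝ (⊤ : ℕ∞) a)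
        (hb : ContDiff ℝ (⊤ : ℕ∞) b) : Integrable fun x => Dpow N k a b x * h x := by
      simpa only [mul_comm] using integrable_mul_Dpow k hh ha hb hhc
    rw [integral_mul_Dpow_succ k hf hg hh hfc]
    simp only [Dpow, Finset.sum_mul, sub_mul]
    rw [integral_finsetSum _ fun i _ =>
      (hi (hf.dq i) (hg.dp i)).sub' (hi (hf.dp i) (hg.dq i))]
    refine Finset.sum_congr rfl fun i _ => ?_
    rw [integral_sub (hi (hf.dq i) (hg.dp i)) (hi (hf.dp i) (hg.dq i)),
      ih _ _ (hf.dq i) (hg.dp i) (hfc.dq i) (hgc.dp i),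
      ih _ _ (hf.dp i) (hg.dq i) (hfc.dp i) (hgc.dq i)]
end

section
/- On the two-dimensional phase space ℝ × ℝ (one position q and one momentum p), for every natural number n the function f(q,p) = (qp)^n satisfies f D_ω^{2n} f = (−1)^n (2n)! (n!)², i.e. (qp)^n D_ω^{2n} (qp)^n is the constant function with value (−1)^n (2n)! (n!)². -/
/-- Partial derivative in the position variable `q` on phase space `ℝ × ℝ`. -/
noncomputable def dq1 (f : ℝ × ℝ → ℝ) : ℝ × ℝ → ℝ :=
  fun x => fderiv ℝ f x (1, 0)

/-- Partial derivative in the momentum variable `p` on phase space `ℝ × ℝ`. -/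
noncomputable def dp1 (f : ℝ × ℝ → ℝ) : ℝ × ℝ → ℝ :=
  fun x => fderiv ℝ f x (0, 1)

/-- Iterated bidifferential operator on `ℝ × ℝ`: `Dpow1 k f g = f D_ω^k g`, with
`f D_ω^0 g = f·g` and
`f D_ω^{k+1} g = (∂f/∂q) D_ω^k (∂g/∂p) − (∂f/∂p) D_ω^k (∂g/∂q)`. -/
noncomputable def Dpow1 : ℕ → (ℝ × ℝ → ℝ) → (ℝ × ℝ → ℝ) → ℝ × ℝ → ℝ
  | 0, f, g => fun x => f x * g x
  | k + 1, f, g => fun x => Dpow1 k (dq1 f) (dp1 g) x - Dpow1 k (dp1 f) (dq1 g) x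

/-- The function `c q ^ a p ^ b` on phase space `ℝ × ℝ`. -/
def phaseMonomial (c : ℝ) (a b : ℕ) : ℝ × ℝ → ℝ :=
  fun x => c * (x.1 ^ a * x.2 ^ b)

theorem dq1_phaseMonomial (c : ℝ) (a b : ℕ) :
    dq1 (phaseMonomial c a b) = phaseMonomial (c * a) (a - 1) b := by
  funext x
  have h := (((hasFDerivAt_fst (𝕜 := ℝ) (p := x)).pow a).mul
    ((hasFDerivAt_snd (𝕜 := ℝ) (p := x)).pow b)).const_mul c
  have h' : fderiv ℝ (phaseMonomial c a b) x = _ := h.fderiv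
  simp [dq1, h', phaseMonomial]
  ring

theorem dp1_phaseMonomial (c : ℝ) (a b : ℕ) :
    dp1 (phaseMonomial c a b) = phaseMonomial (c * b) a (b - 1) := by
  funext x
  have h := (((hasFDerivAt_fst (𝕜 := ℝ) (p := x)).pow a).mul
    ((hasFDerivAt_snd (𝕜 := ℝ) (p := x)).pow b)).const_mul c
  have h' : fderiv ℝ (phaseMonomial c a b) x = _ := h.fderiv
  simp [dp1, h', phaseMonomial]
  ring

theorem cast_descFactorial_succ_eq_mul_pred (a i : ℕ) :
    (a.descFactorial (i + 1) : ℝ) = a * (a - 1).descFactorial i := by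
  cases a with
  | zero => simp
  | succ a => rw [Nat.succ_descFactorial_succ, Nat.add_sub_cancel, Nat.cast_mul]

theorem Dpow1_phaseMonomial (k : ℕ) (c d : ℝ) (a b a' b' : ℕ) (x : ℝ × ℝ) :
    Dpow1 k (phaseMonomial c a b) (phaseMonomial d a' b') x =
      ∑ ij ∈ Finset.HasAntidiagonal.antidiagonal k, (k.choose ij.1 : ℝ) * ((-1) ^ ij.2 *
        (phaseMonomial (c * a.descFactorial ij.1 * b.descFactorial ij.2)
            (a - ij.1) (b - ij.2) x *
          phaseMonomial (d * a'.descFactorial ij.2 * b'.descFactorial ij.1)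
            (a' - ij.2) (b' - ij.1) x)) := by
  induction k generalizing c d a b a' b' with
  | zero => simp [Dpow1]
  | succ k ih =>
    rw [Finset.sum_antidiagonal_choose_succ_mul (R := ℝ) (fun i j => (-1) ^ j *
        (phaseMonomial (c * a.descFactorial i * b.descFactorial j) (a - i) (b - j) x *
          phaseMonomial (d * a'.descFactorial j * b'.descFactorial i) (a' - j) (b' - i) x))]
    simp only [Dpow1, dq1_phaseMonomial, dp1_phaseMonomial, ih]
    rw [sub_eq_add_neg, add_comm, ← Finset.sum_neg_distrib]
    congr 1
    · refine Finset.sum_congr rfl fun ij hij => ?_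
      have hs : k.choose ij.1 = k.choose ij.2 :=
        (Nat.choose_symm_of_eq_add (Finset.HasAntidiagonal.mem_antidiagonal.mp hij).symm)
      simp only [phaseMonomial, cast_descFactorial_succ_eq_mul_pred, Nat.sub_sub,
        add_comm 1, pow_succ (-1 : ℝ), hs]
      ring
    · refine Finset.sum_congr rfl fun ij hij => ?_
      have hs : k.choose ij.1 = k.choose ij.2 :=
        (Nat.choose_symm_of_eq_add (Finset.HasAntidiagonal.mem_antidiagonal.mp hij).symm)
      simp only [phaseMonomial, cast_descFactorial_succ_eq_mul_pred, Nat.sub_sub,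
        add_comm 1, hs]
      ring

/-- On phase space `ℝ × ℝ`, for every `n`, the function `f(q,p) = (qp)^n` satisfies
`f D_ω^{2n} f = (−1)^n (2n)! (n!)²` as a constant function. -/
theorem statement5 (n : ℕ) :
    Dpow1 (2 * n) (fun x => (x.1 * x.2) ^ n) (fun x => (x.1 * x.2) ^ n)
      = fun _ => (-1 : ℝ) ^ n * (Nat.factorial (2 * n) : ℝ) * ((Nat.factorial n : ℝ)) ^ 2 := by
  have hf : (fun x : ℝ × ℝ => (x.1 * x.2) ^ n) = phaseMonomial 1 n n := by
    funext x
    simp [phaseMonomial, mul_pow]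
  funext x
  rw [hf, Dpow1_phaseMonomial, Finset.sum_eq_single (n, n)]
  · have h : ((2 * n).choose n : ℝ) * n.factorial * n.factorial = (2 * n).factorial := by
      have := Nat.choose_mul_factorial_mul_factorial (Nat.le_mul_of_pos_left n two_pos)
      rw [show 2 * n - n = n by omega] at this
      exact_mod_cast this
    simp only [phaseMonomial, Nat.descFactorial_self, Nat.sub_self, pow_zero, ← h]
    ring
  · rintro ⟨i, j⟩ hij hne
    rw [Finset.HasAntidiagonal.mem_antidiagonal] at hij
    have : n < i ∨ n < j := by
      by_contra! h
      exact hne (Prod.ext (by simp_all; omega) (by simp_all; omega))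
    rcases this with h | h <;>
      simp [phaseMonomial, Nat.descFactorial_of_lt h]
  · intro h
    exact absurd (Finset.HasAntidiagonal.mem_antidiagonal.mpr (by simp; omega)) h
end

section
/- On the two-dimensional phase space ℝ × ℝ, for every natural number n the function f(q,p) = (qp)^n satisfies f D_ω^{2ℓ} f = 0 for every ℓ > n, and f D_ω^{2ℓ+1} f = 0 for every natural number ℓ. -/
theorem hasFDerivAt_monomial (a b : ℕ) (c : ℝ) (x : ℝ × ℝ) :
    HasFDerivAt (fun x : ℝ × ℝ => c * x.1 ^ a * x.2 ^ b)
      ((c * a * x.1 ^ (a - 1) * x.2 ^ b) • ContinuousLinearMap.fst ℝ ℝ ℝ +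
        (c * b * x.1 ^ a * x.2 ^ (b - 1)) • ContinuousLinearMap.snd ℝ ℝ ℝ) x := by
  have h := (((hasFDerivAt_fst (𝕜 := ℝ) (E := ℝ) (F := ℝ) (p := x)).pow a).const_mul c).mul
    ((hasFDerivAt_snd (𝕜 := ℝ) (E := ℝ) (F := ℝ) (p := x)).pow b)
  refine h.congr_fderiv (ContinuousLinearMap.ext fun v => ?_)
  simp
  ring

theorem dq1_monomial (a b : ℕ) (c : ℝ) :
    dq1 (fun x => c * x.1 ^ a * x.2 ^ b) = fun x => c * a * x.1 ^ (a - 1) * x.2 ^ b := by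
  funext x
  simp [dq1, (hasFDerivAt_monomial a b c x).fderiv]

theorem dp1_monomial (a b : ℕ) (c : ℝ) :
    dp1 (fun x => c * x.1 ^ a * x.2 ^ b) = fun x => c * b * x.1 ^ a * x.2 ^ (b - 1) := by
  funext x
  simp [dp1, (hasFDerivAt_monomial a b c x).fderiv]

/-- `D_ω^k` annihilates monomials of total degree less than `k`. -/
theorem Dpow1_monomial_eq_zero (k : ℕ) : ∀ (a b : ℕ) (c : ℝ) (g : ℝ × ℝ → ℝ) (x : ℝ × ℝ),
    c = 0 ∨ a + b < k → Dpow1 k (fun x => c * x.1 ^ a * x.2 ^ b) g x = 0 := by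
  induction k with
  | zero =>
    rintro a b c g x (rfl | h)
    · simp [Dpow1]
    · omega
  | succ k ih =>
    intro a b c g x h
    simp only [Dpow1, dq1_monomial, dp1_monomial]
    rw [ih, ih, sub_zero]
    · rcases h with rfl | h
      · simp
      · rcases b with _ | b
        · simp
        · right; omega
    · rcases h with rfl | h
      · simp
      · rcases a with _ | a
        · simp
        · right; omega

/-- `D_ω^k` is symmetric for even `k` and antisymmetric for odd `k`. -/
theorem Dpow1_swap (k : ℕ) (f g : ℝ × ℝ → ℝ) (x : ℝ × ℝ) :
    Dpow1 k f g x = (-1) ^ k * Dpow1 k g f x := by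
  induction k generalizing f g with
  | zero => simp [Dpow1, mul_comm]
  | succ k ih =>
    simp only [Dpow1]
    rw [ih (dq1 f), ih (dp1 f)]
    ring

/-- On phase space `ℝ × ℝ`, for every `n`, the function `f(q,p) = (qp)^n` satisfies
`f D_ω^{2ℓ} f = 0` for every `ℓ > n` and `f D_ω^{2ℓ+1} f = 0` for every `ℓ`. -/
theorem statement6 (n : ℕ) :
    (∀ l : ℕ, n < l →
      Dpow1 (2 * l) (fun x => (x.1 * x.2) ^ n) (fun x => (x.1 * x.2) ^ n) = fun _ => 0) ∧
    (∀ l : ℕ,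
      Dpow1 (2 * l + 1) (fun x => (x.1 * x.2) ^ n) (fun x => (x.1 * x.2) ^ n) = fun _ => 0) := by
  refine ⟨fun l hl => funext fun x => ?_, fun l => funext fun x => ?_⟩
  · have h := Dpow1_monomial_eq_zero (2 * l) n n 1 (fun x => (x.1 * x.2) ^ n) x
      (Or.inr (by omega))
    simpa only [one_mul, ← mul_pow] using h
  · have h := Dpow1_swap (2 * l + 1) (fun x => (x.1 * x.2) ^ n) (fun x => (x.1 * x.2) ^ n) x
    rw [Odd.neg_one_pow ⟨l, rfl⟩] at h
    linarith
end

section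
/- For the Pöschl–Teller Hamiltonian H(q,p) = p²/(2m) + (η²/(2m))·(1 − 2/cosh²(qη/ħ)) and the phase-space function ρ(q,p) = (1/ħ) · sin(2qp/ħ) / (sinh(2qη/ħ) · sinh(πp/η)), the Poisson bracket {H, ρ} is not identically zero on the domain {(q,p) ∈ ℝ² : q ≠ 0, p ≠ 0}. -/
theorem dq1_eq_of_hasDerivAt {f : ℝ × ℝ → ℝ} {q p d : ℝ} (hf : DifferentiableAt ℝ f (q, p))
    (h : HasDerivAt (fun t => f (t, p)) d q) : dq1 f (q, p) = d := by
  have hline : HasDerivAt (fun t : ℝ => (t, p)) ((1 : ℝ), (0 : ℝ)) q :=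
    (hasDerivAt_id q).prodMk (hasDerivAt_const q p)
  exact (hf.hasFDerivAt.comp_hasDerivAt (f := fun t : ℝ => (t, p)) q hline).unique h

theorem dp1_eq_of_hasDerivAt {f : ℝ × ℝ → ℝ} {q p d : ℝ} (hf : DifferentiableAt ℝ f (q, p))
    (h : HasDerivAt (fun t => f (q, t)) d p) : dp1 f (q, p) = d := by
  have hline : HasDerivAt (fun t : ℝ => (q, t)) ((0 : ℝ), (1 : ℝ)) p :=
    (hasDerivAt_const p q).prodMk (hasDerivAt_id p)
  exact (hf.hasFDerivAt.comp_hasDerivAt (f := fun t : ℝ => (q, t)) p hline).unique h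

/-- At a zero of the numerator, the derivative of a quotient is the quotient of the derivative of
the numerator by the denominator. -/
theorem hasDerivAt_div_of_eq_zero {u v : ℝ → ℝ} {u' t : ℝ} (hu : HasDerivAt u u' t)
    (hv : DifferentiableAt ℝ v t) (hv0 : v t ≠ 0) (hu0 : u t = 0) :
    HasDerivAt (fun s => u s / v s) (u' / v t) t := by
  refine (hu.fun_div hv.hasDerivAt hv0).congr_deriv ?_
  rw [hu0]
  field_simp
  ring

/-- For the Pöschl–Teller Hamiltonian `H(q,p) = p²/(2m) + (η²/(2m))(1 − 2/cosh²(qη/ħ))`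
and `ρ(q,p) = (1/ħ) sin(2qp/ħ) / (sinh(2qη/ħ) sinh(πp/η))`, the Poisson bracket
`{H,ρ} = f D_ω^1 g` is not identically zero on `{(q,p) : q ≠ 0, p ≠ 0}`.
Here `m`, `eta`, `hbar` play the roles of the constants `m, η, ħ > 0`. -/
theorem statement10 (m eta hbar : ℝ) (hm : 0 < m) (heta : 0 < eta) (hhbar : 0 < hbar) :
    ∃ x : ℝ × ℝ, x.1 ≠ 0 ∧ x.2 ≠ 0 ∧
      Dpow1 1
        (fun y => y.2 ^ 2 / (2 * m) +
          eta ^ 2 / (2 * m) * (1 - 2 / Real.cosh (y.1 * eta / hbar) ^ 2))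
        (fun y => (1 / hbar) * Real.sin (2 * y.1 * y.2 / hbar) /
          (Real.sinh (2 * y.1 * eta / hbar) * Real.sinh (Real.pi * y.2 / eta)))
        x ≠ 0 := by
  have hq : hbar / eta ≠ 0 := by positivity
  have hp : Real.pi * eta / 2 ≠ 0 := by positivity
  refine ⟨(hbar / eta, Real.pi * eta / 2), hq, hp, ?_⟩
  have harg : 2 * (hbar / eta) * (Real.pi * eta / 2) / hbar = Real.pi := by field_simp
  have ha : hbar / eta * eta / hbar = 1 := by field_simp
  have hS : Real.sinh (2 * (hbar / eta) * eta / hbar) ≠ 0 :=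
    Real.sinh_ne_zero.2 (by positivity)
  have hT : Real.sinh (Real.pi * (Real.pi * eta / 2) / eta) ≠ 0 :=
    Real.sinh_ne_zero.2 (by positivity)
  have hcosh : ∀ y : ℝ, Real.cosh y ^ 2 ≠ 0 := fun y => pow_ne_zero _ (Real.cosh_pos y).ne'
  have hHd : DifferentiableAt ℝ (fun y : ℝ × ℝ => y.2 ^ 2 / (2 * m) +
      eta ^ 2 / (2 * m) * (1 - 2 / Real.cosh (y.1 * eta / hbar) ^ 2))
      (hbar / eta, Real.pi * eta / 2) := by
    have := hcosh (hbar / eta * eta / hbar)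
    fun_prop (disch := assumption)
  have hρd : DifferentiableAt ℝ (fun y : ℝ × ℝ => (1 / hbar) * Real.sin (2 * y.1 * y.2 / hbar) /
      (Real.sinh (2 * y.1 * eta / hbar) * Real.sinh (Real.pi * y.2 / eta)))
      (hbar / eta, Real.pi * eta / 2) := by
    have := mul_ne_zero hS hT
    fun_prop (disch := assumption)
  have hHp := dp1_eq_of_hasDerivAt (d := Real.pi * eta / (2 * m)) hHd (by
    dsimp only
    refine (((hasDerivAt_pow 2 (Real.pi * eta / 2)).div_const (2 * m)).add_const _).congr_deriv ?_
    norm_num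
    field_simp)
  have hHq := dq1_eq_of_hasDerivAt
      (d := 2 * eta ^ 3 / (m * hbar) * (Real.sinh 1 / Real.cosh 1 ^ 3)) hHd (by
    have hlin : HasDerivAt (fun t : ℝ => t * eta / hbar) (1 * eta / hbar) (hbar / eta) :=
      ((hasDerivAt_id _).mul_const eta).div_const hbar
    dsimp only
    refine (((((hasDerivAt_const _ (2 : ℝ)).fun_div (hlin.cosh.fun_pow 2)
      (hcosh _)).const_sub 1).const_mul (eta ^ 2 / (2 * m))).const_add _).congr_deriv ?_
    have := (Real.cosh_pos 1).ne'
    rw [ha]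
    field_simp
    ring)
  have hρq := dq1_eq_of_hasDerivAt hρd (by
    have hlin : HasDerivAt (fun t : ℝ => 2 * t * (Real.pi * eta / 2) / hbar)
        (2 * 1 * (Real.pi * eta / 2) / hbar) (hbar / eta) :=
      (((hasDerivAt_id _).const_mul 2).mul_const _).div_const hbar
    exact hasDerivAt_div_of_eq_zero (hlin.sin.const_mul (1 / hbar)) (by fun_prop)
      (mul_ne_zero hS hT) (by simp [harg]))
  have hρp := dp1_eq_of_hasDerivAt hρd (by
    have hlin : HasDerivAt (fun t : ℝ => 2 * (hbar / eta) * t / hbar)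
        (2 * (hbar / eta) * 1 / hbar) (Real.pi * eta / 2) :=
      ((hasDerivAt_id _).const_mul _).div_const hbar
    exact hasDerivAt_div_of_eq_zero (hlin.sin.const_mul (1 / hbar)) (by fun_prop)
      (mul_ne_zero hS hT) (by simp [harg]))
  simp only [Dpow1]
  rw [hHp, hHq, hρq, hρp, harg, Real.cos_pi]
  have hr : Real.sinh 1 / Real.cosh 1 ^ 3 < 1 := by
    rw [div_lt_one (pow_pos (Real.cosh_pos 1) 3)]
    exact (Real.sinh_lt_cosh 1).trans_le (le_self_pow₀ (Real.one_le_cosh 1) (by norm_num))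
  have hpi : 8 * (Real.sinh 1 / Real.cosh 1 ^ 3) < Real.pi ^ 2 := by
    nlinarith [Real.pi_gt_three]
  generalize Real.sinh 1 / Real.cosh 1 ^ 3 = r at *
  generalize Real.sinh (2 * (hbar / eta) * eta / hbar) = S at *
  generalize Real.sinh (Real.pi * (Real.pi * eta / 2) / eta) = T at *
  have hval : 2 * eta ^ 3 / (m * hbar) * r *
        (1 / hbar * (-1 * (2 * (hbar / eta) * 1 / hbar)) / (S * T)) -
      Real.pi * eta / (2 * m) *
        (1 / hbar * (-1 * (2 * 1 * (Real.pi * eta / 2) / hbar)) / (S * T)) =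
      eta ^ 2 * (Real.pi ^ 2 - 8 * r) / (2 * m * hbar ^ 2 * (S * T)) := by
    field_simp
    ring
  rw [hval]
  have := (sub_pos.2 hpi).ne'
  positivity
end

section
/- Let n ≥ 1 be a natural number, m an integer, and (q,p) ∈ (ℝ³∖{0}) × ℝ³ a phase-space point. If T_n^H(H(q,p)) · T_m^L(L₃(q,p)) ≠ 0, then |m| ≤ 2(n+1). -/
/-- The hydrogen energy levels `E_n = −κ/(2 a₀ n²)` with `a₀ = ħ²/(κμ)`;
`mu`, `kap`, `hbar` play the roles of `μ, κ, ħ`. -/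
noncomputable def En (mu kap hbar : ℝ) (n : ℕ) : ℝ :=
  -kap / (2 * (hbar ^ 2 / (kap * mu)) * (n : ℝ) ^ 2)

/-- The sawtooth functions `T_n^H` used in the phase-space spectral measure of the
energy of the hydrogen atom. -/
noncomputable def TH (mu kap hbar : ℝ) : ℕ → ℝ → ℝ
  | 0 => fun _ => 0
  | 1 => fun x =>
      if x ≤ En mu kap hbar 2 then
        (En mu kap hbar 2 - x) / (En mu kap hbar 2 - En mu kap hbar 1)
      else 0
  | 2 => fun x =>
      if x ≤ En mu kap hbar 2 then
        (x - En mu kap hbar 1) / (En mu kap hbar 2 - En mu kap hbar 1)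
      else if x ≤ En mu kap hbar 3 then
        (En mu kap hbar 3 - x) / (En mu kap hbar 3 - En mu kap hbar 2)
      else 0
  | (n + 3) => fun x =>
      if x < En mu kap hbar (n + 2) then 0
      else if x ≤ En mu kap hbar (n + 3) then
        (x - En mu kap hbar (n + 2)) / (En mu kap hbar (n + 3) - En mu kap hbar (n + 2))
      else if x ≤ En mu kap hbar (n + 4) then
        (En mu kap hbar (n + 4) - x) / (En mu kap hbar (n + 4) - En mu kap hbar (n + 3))
      else 0
/-- The sawtooth functions `T_m^L` used in the phase-space spectral measure of the
angular momentum; `hbar` plays the role of `ħ`. -/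
noncomputable def TL (hbar : ℝ) (m : ℤ) (x : ℝ) : ℝ :=
  if x < ((m : ℝ) - 1) * hbar then 0
  else if x ≤ (m : ℝ) * hbar then (x - ((m : ℝ) - 1) * hbar) / hbar
  else if x ≤ ((m : ℝ) + 1) * hbar then (((m : ℝ) + 1) * hbar - x) / hbar
  else 0

theorem En_eq {mu kap hbar : ℝ} (hmu : 0 < mu) (hkap : 0 < kap) (hhbar : 0 < hbar) {n : ℕ}
    (hn : 0 < n) : En mu kap hbar n = -(kap ^ 2 * mu) / (2 * hbar ^ 2 * (n : ℝ) ^ 2) := by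
  have : (0 : ℝ) < n := by exact_mod_cast hn
  unfold En
  field_simp

theorem En_lt_succ {mu kap hbar : ℝ} (hmu : 0 < mu) (hkap : 0 < kap) (hhbar : 0 < hbar) {n : ℕ}
    (hn : 0 < n) : En mu kap hbar n < En mu kap hbar (n + 1) := by
  have h0 : (0 : ℝ) < n := by exact_mod_cast hn
  rw [En_eq hmu hkap hhbar hn, En_eq hmu hkap hhbar n.succ_pos, neg_div, neg_div, neg_lt_neg_iff]
  push_cast
  gcongr
  linarith

theorem lt_En_succ_of_TH_ne_zero {mu kap hbar : ℝ} (hmu : 0 < mu) (hkap : 0 < kap)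
    (hhbar : 0 < hbar) {n : ℕ} {x : ℝ} (h : TH mu kap hbar n x ≠ 0) :
    x < En mu kap hbar (n + 1) := by
  have key : ∀ a d : ℝ, (a - x) / d ≠ 0 → x ≤ a → x < a := fun a d hne hle =>
    lt_of_le_of_ne hle fun he => hne (by simp [he])
  match n, h with
  | 0, h => exact absurd rfl h
  | 1, h =>
    simp only [TH] at h
    split_ifs at h with h1
    · exact key _ _ h h1
    · exact absurd rfl h
  | 2, h =>
    simp only [TH] at h
    split_ifs at h with h1 h2
    · exact h1.trans_lt (En_lt_succ hmu hkap hhbar two_pos)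
    · exact key _ _ h h2
    · exact absurd rfl h
  | n + 3, h =>
    simp only [TH] at h
    split_ifs at h with h1 h2 h3
    · exact absurd rfl h
    · exact h2.trans_lt (En_lt_succ hmu hkap hhbar (Nat.succ_pos _))
    · exact key _ _ h h3
    · exact absurd rfl h

theorem abs_sub_lt_of_TL_ne_zero {hbar : ℝ} (hhbar : 0 < hbar) {m : ℤ} {x : ℝ}
    (h : TL hbar m x ≠ 0) : |x - m * hbar| < hbar := by
  unfold TL at h
  rw [abs_lt]
  split_ifs at h with h1 h2 h3
  · exact absurd rfl h
  · have : x ≠ ((m : ℝ) - 1) * hbar := fun he => h (by simp [he])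
    have := lt_of_le_of_ne (not_lt.mp h1) this.symm
    constructor <;> linarith
  · have : x ≠ ((m : ℝ) + 1) * hbar := fun he => h (by simp [he])
    have := lt_of_le_of_ne h3 this
    constructor <;> linarith
  · exact absurd rfl h

theorem sq_angularMomentum_le (q p : EuclideanSpace ℝ (Fin 3)) :
    (q 0 * p 1 - q 1 * p 0) ^ 2 ≤ (‖q‖ * ‖p‖) ^ 2 := by
  rw [mul_pow, EuclideanSpace.real_norm_sq_eq, EuclideanSpace.real_norm_sq_eq,
    Fin.sum_univ_three, Fin.sum_univ_three]
  nlinarith [sq_nonneg (q 0 * p 0 + q 1 * p 1), sq_nonneg (q 0 * p 2), sq_nonneg (q 1 * p 2),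
    sq_nonneg (q 2 * p 0), sq_nonneg (q 2 * p 1), sq_nonneg (q 2 * p 2)]

/-- A bound on `r²s²` for a Kepler energy below the level `E_n`: complete the square in `r`. -/
theorem sq_mul_lt_of_energy_lt {mu kap hbar : ℝ} (hmu : 0 < mu) (hkap : 0 < kap)
    (hhbar : 0 < hbar) {n : ℕ} (hn : 0 < n) {r s : ℝ} (hr : 0 < r)
    (h : s ^ 2 / (2 * mu) - kap / r < En mu kap hbar n) :
    (r * s) ^ 2 < (n * hbar) ^ 2 := by
  have hn' : (0 : ℝ) < n := by exact_mod_cast hn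
  rw [En_eq hmu hkap hhbar hn] at h
  have h1 := mul_lt_mul_of_pos_right h (show 0 < 2 * mu * r ^ 2 by positivity)
  have e1 : (s ^ 2 / (2 * mu) - kap / r) * (2 * mu * r ^ 2) =
      (r * s) ^ 2 - 2 * (kap * mu * r) := by
    field_simp
  have e2 : -(kap ^ 2 * mu) / (2 * hbar ^ 2 * (n : ℝ) ^ 2) * (2 * mu * r ^ 2) =
      (n * hbar) ^ 2 - 2 * (kap * mu * r) - (kap * mu * r / (n * hbar) - n * hbar) ^ 2 := by
    field_simp
    ring
  rw [e1, e2] at h1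
  linarith [sq_nonneg (kap * mu * r / (n * hbar) - n * hbar)]

/-- If `n ≥ 1`, `m ∈ ℤ` and `(q,p)` with `q ≠ 0` satisfy
`T_n^H(H(q,p)) · T_m^L(L₃(q,p)) ≠ 0`, where `H(q,p) = |p|²/(2μ) − κ/|q|` and
`L₃(q,p) = q₁p₂ − q₂p₁`, then `|m| ≤ 2(n+1)`. -/
theorem statement16 (mu kap hbar : ℝ) (hmu : 0 < mu) (hkap : 0 < kap) (hhbar : 0 < hbar)
    (n : ℕ) (hn : 1 ≤ n) (m : ℤ) (q p : EuclideanSpace ℝ (Fin 3)) (hq : q ≠ 0)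
    (h : TH mu kap hbar n (‖p‖ ^ 2 / (2 * mu) - kap / ‖q‖) *
        TL hbar m (q 0 * p 1 - q 1 * p 0) ≠ 0) :
    |m| ≤ 2 * ((n : ℤ) + 1) := by
  have hTH := left_ne_zero_of_mul h
  have hTL := right_ne_zero_of_mul h
  have hE := sq_mul_lt_of_energy_lt hmu hkap hhbar n.succ_pos (norm_pos_iff.mpr hq)
    (lt_En_succ_of_TH_ne_zero hmu hkap hhbar hTH)
  have hL : |q 0 * p 1 - q 1 * p 0| < ((n + 1 : ℕ) : ℝ) * hbar :=
    abs_lt_of_sq_lt_sq ((sq_angularMomentum_le q p).trans_lt hE) (by positivity)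
  have hm := abs_lt.mp (abs_sub_lt_of_TL_ne_zero hhbar hTL)
  have hL := abs_lt.mp hL
  have hlt : |(m : ℝ)| < (n : ℝ) + 2 := by
    push_cast at hL
    rw [abs_lt]
    constructor <;> refine lt_of_mul_lt_mul_right ?_ hhbar.le <;> linarith
  have hlt : |m| < (n : ℤ) + 2 := by exact_mod_cast hlt
  omega
end

section
/- Generalized Ehrenfest identities: let T be a smooth function of p ∈ ℝ^N, V a smooth function of q ∈ ℝ^N, and H(q,p) = T(p) + V(q). Then for each index i, the coordinate functions Q_i(q,p) = q_i and P_i(q,p) = p_i satisfy −⟦H, Q_i⟧ = ∂T/∂p_i (the velocity observable) and −⟦H, P_i⟧ = −∂V/∂q_i (the force observable), where ⟦·,·⟧ is the generalized Moyal bracket. -/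
/-- The generalized Moyal bracket `⟦f,g⟧ = ∑_{n=0}^{N₀} a_n ħ^{2n} (f D_ω^{2n+1} g)`,
where `hbar` plays the role of `ħ`. -/
noncomputable def gmb (N : ℕ) (a : ℕ → ℝ) (hbar : ℝ) (N₀ : ℕ)
    (f g : (Fin N → ℝ) × (Fin N → ℝ) → ℝ) : (Fin N → ℝ) × (Fin N → ℝ) → ℝ :=
  fun x => ∑ n ∈ Finset.range (N₀ + 1), a n * hbar ^ (2 * n) * Dpow N (2 * n + 1) f g x

theorem dq_const (N : ℕ) (j : Fin N) (c : ℝ) : dq N j (fun _ => c) = fun _ => 0 := by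
  funext x
  simp [dq]

theorem dp_const (N : ℕ) (j : Fin N) (c : ℝ) : dp N j (fun _ => c) = fun _ => 0 := by
  funext x
  simp [dp]

theorem hasFDerivAt_fst_apply (N : ℕ) (i : Fin N) (x : (Fin N → ℝ) × (Fin N → ℝ)) :
    HasFDerivAt (fun y : (Fin N → ℝ) × (Fin N → ℝ) => y.1 i)
      ((ContinuousLinearMap.proj i).comp
        (ContinuousLinearMap.fst ℝ (Fin N → ℝ) (Fin N → ℝ)) :
          ((Fin N → ℝ) × (Fin N → ℝ)) →L[ℝ] ℝ) x :=
  ((ContinuousLinearMap.proj i).comp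
    (ContinuousLinearMap.fst ℝ (Fin N → ℝ) (Fin N → ℝ))).hasFDerivAt

theorem hasFDerivAt_snd_apply (N : ℕ) (i : Fin N) (x : (Fin N → ℝ) × (Fin N → ℝ)) :
    HasFDerivAt (fun y : (Fin N → ℝ) × (Fin N → ℝ) => y.2 i)
      ((ContinuousLinearMap.proj i).comp
        (ContinuousLinearMap.snd ℝ (Fin N → ℝ) (Fin N → ℝ)) :
          ((Fin N → ℝ) × (Fin N → ℝ)) →L[ℝ] ℝ) x :=
  ((ContinuousLinearMap.proj i).comp
    (ContinuousLinearMap.snd ℝ (Fin N → ℝ) (Fin N → ℝ))).hasFDerivAt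

theorem dq_fst_apply (N : ℕ) (i j : Fin N) :
    dq N j (fun y => y.1 i) = fun _ => if i = j then 1 else 0 := by
  funext x
  simp [dq, (hasFDerivAt_fst_apply N i x).fderiv, Pi.single_apply]

theorem dp_fst_apply (N : ℕ) (i j : Fin N) : dp N j (fun y => y.1 i) = fun _ => 0 := by
  funext x
  simp [dp, (hasFDerivAt_fst_apply N i x).fderiv]

theorem dq_snd_apply (N : ℕ) (i j : Fin N) : dq N j (fun y => y.2 i) = fun _ => 0 := by
  funext x
  simp [dq, (hasFDerivAt_snd_apply N i x).fderiv]

theorem dp_snd_apply (N : ℕ) (i j : Fin N) :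
    dp N j (fun y => y.2 i) = fun _ => if i = j then 1 else 0 := by
  funext x
  simp [dp, (hasFDerivAt_snd_apply N i x).fderiv, Pi.single_apply]

theorem hasFDerivAt_kinetic_add_potential {N : ℕ} {T V : (Fin N → ℝ) → ℝ}
    (hT : Differentiable ℝ T) (hV : Differentiable ℝ V) (x : (Fin N → ℝ) × (Fin N → ℝ)) :
    HasFDerivAt (fun y : (Fin N → ℝ) × (Fin N → ℝ) => T y.2 + V y.1)
      ((fderiv ℝ T x.2).comp (ContinuousLinearMap.snd ℝ (Fin N → ℝ) (Fin N → ℝ)) +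
        (fderiv ℝ V x.1).comp (ContinuousLinearMap.fst ℝ (Fin N → ℝ) (Fin N → ℝ))) x :=
  ((hT x.2).hasFDerivAt.comp x hasFDerivAt_snd).add
    ((hV x.1).hasFDerivAt.comp x hasFDerivAt_fst)

theorem Dpow_zero_right (N k : ℕ) (f : (Fin N → ℝ) × (Fin N → ℝ) → ℝ) :
    Dpow N k f (fun _ => 0) = fun _ => 0 := by
  induction k generalizing f with
  | zero => simp [Dpow]
  | succ k ih => simp [Dpow, dq_const, dp_const, ih]

theorem Dpow_succ_const_right (N k : ℕ) (f : (Fin N → ℝ) × (Fin N → ℝ) → ℝ) (c : ℝ) :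
    Dpow N (k + 1) f (fun _ => c) = fun _ => 0 := by
  simp [Dpow, dq_const, dp_const, Dpow_zero_right]

/-- If all first partial derivatives of `g` are constant, only the Poisson bracket term of
the generalized Moyal bracket survives. -/
theorem gmb_eq_of_const_partials (N : ℕ) (a : ℕ → ℝ) (hbar : ℝ) (N₀ : ℕ) (ha0 : a 0 = 1)
    (f g : (Fin N → ℝ) × (Fin N → ℝ) → ℝ) (c d : Fin N → ℝ)
    (hc : ∀ j, dq N j g = fun _ => c j) (hd : ∀ j, dp N j g = fun _ => d j)
    (x : (Fin N → ℝ) × (Fin N → ℝ)) :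
    gmb N a hbar N₀ f g x = ∑ j, (dq N j f x * d j - dp N j f x * c j) := by
  have higher : ∀ n, Dpow N (2 * (n + 1) + 1) f g x = 0 := fun n => by
    change Dpow N (2 * n + 1 + 1 + 1) f g x = 0
    rw [Dpow]
    simp [hc, hd, Dpow_succ_const_right]
  simp only [gmb, Finset.sum_range_succ', higher]
  simp [ha0, Dpow, hc, hd]

/-- Generalized Ehrenfest identities: for `H(q,p) = T(p) + V(q)` with smooth `T, V`, the
coordinate observables `Q_i(q,p) = q_i` and `P_i(q,p) = p_i` satisfy
`−⟦H, Q_i⟧ = ∂T/∂p_i` (velocity) and `−⟦H, P_i⟧ = −∂V/∂q_i` (force), where `⟦·,·⟧` is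
the generalized Moyal bracket. -/
theorem statement19 (N : ℕ) (hbar : ℝ) (hhbar : 0 < hbar) (a : ℕ → ℝ) (N₀ : ℕ)
    (ha0 : a 0 = 1) (haN : ∀ k, N₀ < k → a k = 0)
    (T V : (Fin N → ℝ) → ℝ) (hT : ContDiff ℝ (⊤ : ℕ∞) T) (hV : ContDiff ℝ (⊤ : ℕ∞) V) (i : Fin N) :
    (fun x => -gmb N a hbar N₀ (fun y => T y.2 + V y.1) (fun y => y.1 i) x)
        = (fun x : (Fin N → ℝ) × (Fin N → ℝ) => fderiv ℝ T x.2 (Pi.single i 1)) ∧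
      (fun x => -gmb N a hbar N₀ (fun y => T y.2 + V y.1) (fun y => y.2 i) x)
        = (fun x : (Fin N → ℝ) × (Fin N → ℝ) => -fderiv ℝ V x.1 (Pi.single i 1)) := by
  have hT' : Differentiable ℝ T := hT.differentiable (by simp)
  have hV' : Differentiable ℝ V := hV.differentiable (by simp)
  constructor
  · funext x
    rw [gmb_eq_of_const_partials N a hbar N₀ ha0 _ _ _ _ (dq_fst_apply N i) (dp_fst_apply N i)]
    simp [dp, (hasFDerivAt_kinetic_add_potential hT' hV' x).fderiv]
  · funext x
    rw [gmb_eq_of_const_partials N a hbar N₀ ha0 _ _ _ _ (dq_snd_apply N i) (dp_snd_apply N i)]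
    simp [dq, (hasFDerivAt_kinetic_add_potential hT' hV' x).fderiv]
end
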